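/- arXiv:2512.15527 — 2 statements merged into one kernel-verified Lean document; each statement's English description precedes it below -/
import Mathlib

section
/- Let ν ∈ (0,1), let E_ν be the Mittag-Leffler function, and let κ : ℝ^h → ℝ be twice continuously differentiable on a neighborhood of the origin with κ(0) = 0 and ∇κ(0) = 0, whose Hessian matrix Q at 0 is positive semidefinite and not the null matrix. Let (a_t)_{t>0} be positive numbers with a_t → 0 and t·a_t → ∞ as t → ∞. Then for every θ ∈ ℝ^h, lim_{t→∞} a_t · log E_ν( κ( (a_t t)^{−ν/2} θ ) · t^ν ) = ( ⟨θ, Qθ⟩ / 2 )^{1/ν}. (This is the Gärtner–Ellis limit underlying the noncentral moderate deviation principle for time-changed Lévy processes when ∇κ_S(0) = 0.) -/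
open Filter Matrix

/-- The Mittag-Leffler function `E_ν(x) = ∑_{k=0}^∞ x^k / Γ(ν k + 1)`. -/
noncomputable def mittagLeffler (ν x : ℝ) : ℝ :=
  ∑' k : ℕ, x ^ k / Real.Gamma (ν * k + 1)

open MeasureTheory Set in
lemma ml_gamma_ge {s y : ℝ} (hs : 0 ≤ s) (hy : 0 ≤ y) :
    y ^ s * Real.exp (-y) ≤ Real.Gamma (s + 1) := by
  rw [Real.Gamma_eq_integral (by linarith)]
  have hint := Real.GammaIntegral_convergent (s := s + 1) (by linarith)
  rw [← integral_exp_neg_Ioi, ← integral_const_mul]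
  calc ∫ u in Ioi y, y ^ s * Real.exp (-u)
      ≤ ∫ u in Ioi y, Real.exp (-u) * u ^ (s + 1 - 1) := by
        refine setIntegral_mono_on ?_ (hint.mono_set (Ioi_subset_Ioi hy)) measurableSet_Ioi ?_
        · exact (integrableOn_exp_neg_Ioi y).const_mul _
        · intro u hu
          rw [mul_comm, add_sub_cancel_right]
          exact mul_le_mul_of_nonneg_left (Real.rpow_le_rpow hy (le_of_lt hu) hs)
            (Real.exp_pos _).le
    _ ≤ ∫ u in Ioi 0, Real.exp (-u) * u ^ (s + 1 - 1) := by
        refine setIntegral_mono_set hint ?_ (Ioi_subset_Ioi hy).eventuallyLE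
        filter_upwards [ae_restrict_mem measurableSet_Ioi] with u hu
        have : (0:ℝ) < u := hu
        simp only [Pi.zero_apply]
        positivity

lemma ml_gamma_pos {ν : ℝ} (hν : 0 < ν) (k : ℕ) : 0 < Real.Gamma (ν * k + 1) :=
  Real.Gamma_pos_of_pos (by positivity)

lemma ml_term_bound {ν z : ℝ} (hν : 0 < ν) (hz : 0 ≤ z) (k : ℕ) :
    z ^ k / Real.Gamma (ν * k + 1) ≤ Real.exp (z ^ (1 / ν)) := by
  rw [div_le_iff₀ (ml_gamma_pos hν k)]
  have h := ml_gamma_ge (s := ν * k) (y := z ^ (1 / ν)) (by positivity) (by positivity)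
  rw [← Real.rpow_mul hz, Real.exp_neg] at h
  have e : 1 / ν * (ν * k) = k := by field_simp
  rw [e, Real.rpow_natCast] at h
  have hp := Real.exp_pos (z ^ (1 / ν))
  rw [← div_eq_mul_inv, div_le_iff₀ hp] at h
  linarith

lemma ml_term_bound' {ν x r : ℝ} (hν : 0 < ν) (hx : 0 ≤ x) (hr : 1 < r) (k : ℕ) :
    x ^ k / Real.Gamma (ν * k + 1) ≤ Real.exp ((r * x) ^ (1 / ν)) * (r⁻¹) ^ k := by
  have h := ml_term_bound (z := r * x) hν (by positivity) k
  have hr0 : (0:ℝ) < r ^ k := by positivity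
  rw [inv_pow, ← div_eq_mul_inv, le_div_iff₀ hr0]
  rw [mul_pow] at h
  calc _ = r ^ k * x ^ k / Real.Gamma (ν * k + 1) := by ring
    _ ≤ _ := h

lemma ml_summable_abs {ν : ℝ} (hν : 0 < ν) (x : ℝ) :
    Summable (fun k : ℕ => |x| ^ k / Real.Gamma (ν * k + 1)) := by
  refine Summable.of_nonneg_of_le
    (fun k => div_nonneg (by positivity) (ml_gamma_pos hν k).le)
    (fun k => ml_term_bound' hν (abs_nonneg x) (one_lt_two) k) ?_
  exact (summable_geometric_of_lt_one (by norm_num) (by norm_num)).mul_left _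

lemma ml_summable {ν : ℝ} (hν : 0 < ν) (x : ℝ) :
    Summable (fun k : ℕ => x ^ k / Real.Gamma (ν * k + 1)) := by
  refine Summable.of_abs ((ml_summable_abs hν x).congr fun k => ?_)
  rw [abs_div, abs_pow, abs_of_pos (ml_gamma_pos hν k)]

lemma ml_le {ν x r : ℝ} (hν : 0 < ν) (hx : 0 ≤ x) (hr : 1 < r) :
    mittagLeffler ν x ≤ Real.exp ((r * x) ^ (1 / ν)) * (1 - r⁻¹)⁻¹ := by
  have hr1 : r⁻¹ < 1 := inv_lt_one_of_one_lt₀ hr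
  have hr0 : 0 ≤ r⁻¹ := by positivity
  rw [← tsum_geometric_of_lt_one hr0 hr1, ← tsum_mul_left]
  exact (ml_summable hν x).tsum_le_tsum (fun k => ml_term_bound' hν hx hr k)
    ((summable_geometric_of_lt_one hr0 hr1).mul_left _)

lemma ml_le_abs {ν : ℝ} (hν : 0 < ν) (x : ℝ) : mittagLeffler ν x ≤ mittagLeffler ν |x| := by
  refine (ml_summable hν x).tsum_le_tsum (fun k => ?_) (ml_summable hν _)
  refine div_le_div_of_nonneg_right ?_ (ml_gamma_pos hν k).le
  rw [← abs_pow]; exact le_abs_self _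

lemma ml_one_le {ν x : ℝ} (hν : 0 < ν) (hx : 0 ≤ x) : 1 ≤ mittagLeffler ν x := by
  have := (ml_summable hν x).le_tsum 0
    (fun k _ => div_nonneg (by positivity) (ml_gamma_pos hν k).le)
  simpa [mittagLeffler] using this

lemma ml_zero {ν : ℝ} : mittagLeffler ν 0 = 1 := by
  unfold mittagLeffler
  rw [tsum_eq_single 0]
  · simp
  · intro k hk; simp [hk]

lemma ml_lower {ν y : ℝ} (hν : ν ∈ Set.Ioo (0 : ℝ) 1) (hy : 1 ≤ y) :
    Real.exp y - 1 ≤ y * mittagLeffler ν (y ^ ν) := by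
  obtain ⟨h0, h1⟩ := hν
  have hy0 : 0 < y := by linarith
  let i : ℕ → ℕ := fun n => ⌈(n : ℝ) / ν⌉₊
  have hi1 : ∀ n : ℕ, (n : ℝ) ≤ ν * i n := fun n => by
    have := Nat.le_ceil ((n : ℝ) / ν)
    rw [div_le_iff₀ h0] at this
    linarith
  have hi2 : ∀ n : ℕ, ν * i n < n + 1 := fun n => by
    have := Nat.ceil_lt_add_one (a := (n : ℝ) / ν) (by positivity)
    have h3 : ν * i n < ν * ((n : ℝ) / ν + 1) := mul_lt_mul_of_pos_left this h0
    have : ν * ((n : ℝ) / ν + 1) = n + ν := by field_simp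
    linarith
  have hinj : Function.Injective i := by
    intro m n hmn
    have a1 := hi1 m; have a2 := hi2 m; have a3 := hi1 n; have a4 := hi2 n
    rw [hmn] at a1 a2
    have b1 : (m : ℝ) < (n + 1 : ℕ) := by push_cast; linarith
    have b2 : (n : ℝ) < (m + 1 : ℕ) := by push_cast; linarith
    rw [Nat.cast_lt] at b1 b2
    omega
  have hsum := ml_summable h0 (y ^ ν)
  have hle := tsum_comp_le_tsum_of_inj hsum
    (fun k => div_nonneg (by positivity) (ml_gamma_pos h0 k).le) hinj
  have hterm : ∀ n : ℕ, y ^ n / ((n + 1).factorial : ℝ)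
      ≤ (y ^ ν) ^ (i n) / Real.Gamma (ν * (i n) + 1) := by
    intro n
    apply div_le_div₀ (by positivity)
    · rw [← Real.rpow_natCast (y ^ ν), ← Real.rpow_mul hy0.le, ← Real.rpow_natCast y n]
      exact Real.rpow_le_rpow_of_exponent_le hy (hi1 n)
    · exact ml_gamma_pos h0 _
    · have := Real.convexOn_Gamma.le_max_of_mem_Icc (x := (n : ℝ) + 1) (y := (n : ℝ) + 1 + 1)
        (z := ν * i n + 1) (Set.mem_Ioi.2 (by positivity)) (Set.mem_Ioi.2 (by positivity))
        ⟨by linarith [hi1 n], by linarith [hi2 n]⟩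
      refine this.trans (max_le ?_ ?_)
      · rw [Real.Gamma_nat_eq_factorial]
        exact_mod_cast Nat.factorial_le (Nat.le_succ n)
      · have := Real.Gamma_nat_eq_factorial (n + 1)
        push_cast at this
        rw [this]
  have hexp : HasSum (fun n : ℕ => y ^ n / (n.factorial : ℝ)) (Real.exp y) := by
    rw [Real.exp_eq_exp_ℝ]
    exact NormedSpace.expSeries_div_hasSum_exp y
  have hexp1 : HasSum (fun n : ℕ => y ^ (n + 1) / ((n + 1).factorial : ℝ)) (Real.exp y - 1) := by
    have := (hasSum_nat_add_iff' 1).2 hexp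
    simpa using this
  rw [← hexp1.tsum_eq]
  have e : ∀ n : ℕ, y ^ (n + 1) / ((n + 1).factorial : ℝ)
      = y * (y ^ n / ((n + 1).factorial : ℝ)) := fun n => by ring
  have hs2 : Summable (fun n : ℕ => y ^ n / ((n + 1).factorial : ℝ)) :=
    Summable.of_nonneg_of_le (fun n => by positivity) hterm (hsum.comp_injective hinj)
  simp_rw [e]
  rw [tsum_mul_left]
  refine mul_le_mul_of_nonneg_left ?_ hy0.le
  exact (hs2.tsum_le_tsum hterm (hsum.comp_injective hinj)).trans hle

open MeasureTheory Set in
lemma ml_beta {u v : ℝ} (hu : 0 < u) (hv : 0 < v) :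
    IntervalIntegrable (fun x : ℝ => x ^ (u - 1) * (1 - x) ^ (v - 1)) volume 0 1 ∧
    ∫ x in (0:ℝ)..1, x ^ (u - 1) * (1 - x) ^ (v - 1)
      = Real.Gamma u * Real.Gamma v / Real.Gamma (u + v) := by
  have hc := Complex.betaIntegral_convergent (u := u) (v := v) (by simpa) (by simpa)
  have hcongr : ∀ x ∈ Icc (0:ℝ) 1, (x : ℂ) ^ ((u : ℂ) - 1) * (1 - (x : ℂ)) ^ ((v : ℂ) - 1)
      = ((x ^ (u - 1) * (1 - x) ^ (v - 1) : ℝ) : ℂ) := by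
    intro x hx
    rw [Complex.ofReal_mul, Complex.ofReal_cpow hx.1, Complex.ofReal_cpow (by linarith [hx.2])]
    push_cast
    rfl
  have hc' : IntervalIntegrable
      (fun x : ℝ => ((x ^ (u - 1) * (1 - x) ^ (v - 1) : ℝ) : ℂ)) volume 0 1 := by
    rw [intervalIntegrable_iff_integrableOn_Ioc_of_le zero_le_one] at hc ⊢
    exact hc.congr_fun (fun x hx => hcongr x ⟨hx.1.le, hx.2⟩) measurableSet_Ioc
  constructor
  · rw [intervalIntegrable_iff_integrableOn_Ioc_of_le zero_le_one] at hc' ⊢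
    have := MeasureTheory.Integrable.re hc'
    simp only [RCLike.re_to_complex, Complex.ofReal_re] at this
    exact this
  · have h := ProbabilityTheory.beta_eq_betaIntegralReal u v hu hv
    have h2 : Complex.betaIntegral u v
        = ((∫ x in (0:ℝ)..1, x ^ (u - 1) * (1 - x) ^ (v - 1) : ℝ) : ℂ) := by
      rw [Complex.betaIntegral, ← intervalIntegral.integral_ofReal]
      refine intervalIntegral.integral_congr (fun x hx => ?_)
      rw [uIcc_of_le zero_le_one] at hx
      exact hcongr x hx
    rw [h2, Complex.ofReal_re] at h
    rw [← h, ProbabilityTheory.beta]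

lemma ml_one_sub_rpow_le {β s : ℝ} (hβ : 0 < β) (hs0 : 0 ≤ s) (hs1 : s ≤ 1) :
    1 - s ^ β ≤ (1 + β) * (1 - s) := by
  rcases le_total 1 β with h | h
  · have := one_add_mul_self_le_rpow_one_add (s := s - 1) (by linarith) h
    rw [add_sub_cancel] at this
    nlinarith
  · have := Real.rpow_le_rpow_of_exponent_ge' hs0 hs1 hβ.le h
    rw [Real.rpow_one] at this
    nlinarith

/-- Marchaud kernel integral of a monomial. -/
lemma ml_marchaud {ν β : ℝ} (hν : ν ∈ Set.Ioo (0 : ℝ) 1) (hβ : 0 < β) :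
    MeasureTheory.IntegrableOn (fun s : ℝ => (1 - s) ^ (-ν - 1) * (1 - s ^ β)) (Set.Ioo 0 1) ∧
    ν * (∫ s in Set.Ioo (0:ℝ) 1, (1 - s) ^ (-ν - 1) * (1 - s ^ β)) + 1
      = Real.Gamma (1 - ν) * Real.Gamma (β + 1) / Real.Gamma (β + 1 - ν) := by
  obtain ⟨h0, h1⟩ := hν
  have hb := ml_beta (u := 1) (v := 1 - ν) one_pos (by linarith)
  obtain ⟨hb1, hb2⟩ := ml_beta (u := β) (v := 1 - ν) hβ (by linarith)
  have hbound : ∀ s ∈ Set.Ioo (0:ℝ) 1,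
      (1 - s) ^ (-ν - 1) * (1 - s ^ β) ≤ (1 + β) * (1 - s) ^ (-ν) := by
    intro s hs
    have h1s : 0 < 1 - s := by linarith [hs.2]
    have := ml_one_sub_rpow_le hβ hs.1.le hs.2.le
    calc _ ≤ (1 - s) ^ (-ν - 1) * ((1 + β) * (1 - s)) := by gcongr
      _ = (1 + β) * ((1 - s) ^ (-ν - 1) * (1 - s)) := by ring
      _ = _ := by
        congr 1
        rw [Real.rpow_sub_one h1s.ne']; field_simp
  have hnn : ∀ s ∈ Set.Ioo (0:ℝ) 1, 0 ≤ (1 - s) ^ (-ν - 1) * (1 - s ^ β) := by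
    intro s hs
    have h1s : 0 < 1 - s := by linarith [hs.2]
    have := Real.rpow_le_one hs.1.le hs.2.le hβ.le
    exact mul_nonneg (by positivity) (by linarith)
  have hG : MeasureTheory.IntegrableOn (fun s : ℝ => (1 - s) ^ (-ν - 1) * (1 - s ^ β))
      (Set.Ioo 0 1) := by
    have hi := (intervalIntegrable_iff_integrableOn_Ioo_of_le zero_le_one).1 (hb.1.const_mul (1 + β))
    refine MeasureTheory.Integrable.mono' hi (by fun_prop) ?_
    filter_upwards [MeasureTheory.ae_restrict_mem measurableSet_Ioo] with s hs
    rw [Real.norm_of_nonneg (hnn s hs)]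
    refine (hbound s hs).trans (le_of_eq ?_)
    rw [sub_self, Real.rpow_zero, one_mul]
    congr 2; ring
  refine ⟨hG, ?_⟩
  have hGi : IntervalIntegrable (fun s : ℝ => (1 - s) ^ (-ν - 1) * (1 - s ^ β))
      MeasureTheory.volume 0 1 := (intervalIntegrable_iff_integrableOn_Ioo_of_le zero_le_one).2 hG
  have hder : ∀ s ∈ Set.Ioo (0:ℝ) 1, HasDerivAt (fun s : ℝ => (1 - s) ^ (-ν) * (1 - s ^ β))
      (ν * ((1 - s) ^ (-ν - 1) * (1 - s ^ β)) - β * (s ^ (β - 1) * (1 - s) ^ (1 - ν - 1))) s := by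
    intro s hs
    have h1s : 0 < 1 - s := by linarith [hs.2]
    have d1 : HasDerivAt (fun s : ℝ => (1 - s) ^ (-ν)) (ν * (1 - s) ^ (-ν - 1)) s := by
      have := ((hasDerivAt_id s).const_sub 1).rpow_const (p := -ν) (Or.inl h1s.ne')
      refine this.congr_deriv ?_
      simp only [id]; ring
    have d2 : HasDerivAt (fun s : ℝ => 1 - s ^ β) (-(β * s ^ (β - 1))) s :=
      (Real.hasDerivAt_rpow_const (Or.inl hs.1.ne')).const_sub 1
    refine (d1.mul d2).congr_deriv ?_
    rw [show 1 - ν - 1 = -ν by ring]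
    ring
  have hint := (hGi.const_mul ν).sub (hb1.const_mul β)
  have hFTC := intervalIntegral.integral_eq_sub_of_hasDerivAt_of_tendsto (fa := 1) (fb := 0)
    zero_lt_one hder hint ?_ ?_
  · rw [intervalIntegral.integral_sub (hGi.const_mul ν) (hb1.const_mul β),
      intervalIntegral.integral_const_mul, intervalIntegral.integral_const_mul, hb2,
      intervalIntegral.integral_of_le zero_le_one, MeasureTheory.integral_Ioc_eq_integral_Ioo]
      at hFTC
    rw [Real.Gamma_add_one hβ.ne', show β + 1 - ν = β + (1 - ν) by ring]
    have : Real.Gamma (1 - ν) * (β * Real.Gamma β) / Real.Gamma (β + (1 - ν))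
      = β * (Real.Gamma β * Real.Gamma (1 - ν) / Real.Gamma (β + (1 - ν))) := by ring
    rw [this]; linarith
  · have : ContinuousAt (fun s : ℝ => (1 - s) ^ (-ν) * (1 - s ^ β)) 0 := by
      refine ContinuousAt.mul (ContinuousAt.rpow_const (by fun_prop) (Or.inl (by norm_num))) ?_
      exact (continuousAt_const).sub (Real.continuousAt_rpow_const _ _ (Or.inr hβ.le))
    have h := this.tendsto.mono_left (nhdsWithin_le_nhds (s := Set.Ioi 0))
    simpa [Real.zero_rpow hβ.ne'] using h
  · have hu : Tendsto (fun s : ℝ => (1 + β) * (1 - s) ^ (1 - ν)) (nhdsWithin 1 (Set.Iio 1))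
        (nhds 0) := by
      have : ContinuousAt (fun s : ℝ => (1 + β) * (1 - s) ^ (1 - ν)) 1 := by
        refine continuousAt_const.mul (ContinuousAt.rpow_const (by fun_prop) (Or.inr (by linarith)))
      have h := this.tendsto.mono_left (nhdsWithin_le_nhds (s := Set.Iio 1))
      simpa [Real.zero_rpow (show 1 - ν ≠ 0 by linarith)] using h
    have hev : ∀ᶠ s : ℝ in nhdsWithin 1 (Set.Iio 1), s ∈ Set.Ioo (0:ℝ) 1 :=
      Ioo_mem_nhdsLT zero_lt_one
    refine tendsto_of_tendsto_of_tendsto_of_le_of_le' tendsto_const_nhds hu ?_ ?_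
    · filter_upwards [hev] with s hs
      have h1s : 0 < 1 - s := by linarith [hs.2]
      have := Real.rpow_le_one hs.1.le hs.2.le hβ.le
      exact mul_nonneg (by positivity) (by linarith)
    · filter_upwards [hev] with s hs
      have h1s : 0 < 1 - s := by linarith [hs.2]
      have := ml_one_sub_rpow_le hβ hs.1.le hs.2.le
      calc _ ≤ (1 - s) ^ (-ν) * ((1 + β) * (1 - s)) := by gcongr
        _ = _ := by
          rw [show 1 - ν = -ν + 1 by ring, Real.rpow_add_one h1s.ne']; ring

open MeasureTheory in
lemma ml_neg_of_min {ν x : ℝ} (hν : ν ∈ Set.Ioo (0 : ℝ) 1) (hx : 0 < x)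
    (hmin : ∀ z ∈ Set.Icc 0 x, mittagLeffler ν (-x) ≤ mittagLeffler ν (-z)) :
    1 ≤ mittagLeffler ν (-x) * (1 + Real.Gamma (1 - ν) * x) := by
  have h0 := hν.1
  have h1 := hν.2
  set c : ℕ → ℝ := fun k => (-x) ^ k / Real.Gamma (ν * k + 1) with hc
  set G : ℕ → ℝ → ℝ := fun k s => (1 - s) ^ (-ν - 1) * (1 - s ^ (ν * k)) with hG
  set μ := volume.restrict (Set.Ioo (0:ℝ) 1) with hμ
  have hcs : Summable c := ml_summable h0 (-x)
  have hcE : HasSum c (mittagLeffler ν (-x)) := hcs.hasSum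
  have hkpos : ∀ j : ℕ, 0 < ν * ((j + 1 : ℕ) : ℝ) := fun j => by positivity
  have hG0 : G 0 = fun _ => 0 := by funext s; simp [hG]
  have hGint : ∀ k, Integrable (G k) μ := by
    intro k
    cases k with
    | zero => rw [hG0]; exact integrable_zero _ _ _
    | succ j => exact (ml_marchaud hν (hkpos j)).1
  have hval : ∀ j, ν * (∫ s, G (j + 1) s ∂μ) + 1
      = Real.Gamma (1 - ν) * Real.Gamma (ν * (j + 1 : ℕ) + 1) / Real.Gamma (ν * j + 1) := by
    intro j
    have := (ml_marchaud hν (hkpos j)).2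
    rw [show ν * ((j + 1 : ℕ) : ℝ) + 1 - ν = ν * j + 1 by push_cast; ring] at this
    exact this
  have hGnn : ∀ k, ∀ s ∈ Set.Ioo (0:ℝ) 1, 0 ≤ G k s := by
    intro k s hs
    have h1s : 0 < 1 - s := by linarith [hs.2]
    have := Real.rpow_le_one hs.1.le hs.2.le (show 0 ≤ ν * k by positivity)
    exact mul_nonneg (by positivity) (by linarith)
  have hterm : ∀ j, c (j + 1) * (ν * ∫ s, G (j + 1) s ∂μ)
      = -(x * Real.Gamma (1 - ν)) * c j - c (j + 1) := by
    intro j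
    have e : ν * (∫ s, G (j + 1) s ∂μ) = Real.Gamma (1 - ν) * Real.Gamma (ν * (j + 1 : ℕ) + 1) /
      Real.Gamma (ν * j + 1) - 1 := by linarith [hval j]
    rw [e]
    simp only [hc]
    have g1 := (ml_gamma_pos h0 j).ne'
    have g2 := (ml_gamma_pos h0 (j + 1)).ne'
    field_simp
    ring
  have hsum1 : Summable fun j => c (j + 1) * (ν * ∫ s, G (j + 1) s ∂μ) := by
    simp_rw [hterm]
    exact (hcs.mul_left _).sub ((summable_nat_add_iff 1).2 hcs)
  have hnorm : ∀ k, ∫ s, ‖c k * G k s‖ ∂μ = |c k| * ∫ s, G k s ∂μ := by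
    intro k
    rw [← integral_const_mul]
    refine setIntegral_congr_fun measurableSet_Ioo (fun s hs => ?_)
    simp only [norm_mul, Real.norm_eq_abs, abs_of_nonneg (hGnn k s hs)]
  have hsum2 : Summable fun k => ∫ s, ‖c k * G k s‖ ∂μ := by
    rw [← summable_nat_add_iff 1]
    refine (hsum1.abs.mul_left ν⁻¹).congr (fun j => ?_)
    rw [hnorm, abs_mul, abs_mul, abs_of_pos h0,
      abs_of_nonneg (setIntegral_nonneg measurableSet_Ioo (hGnn (j + 1)))]
    field_simp
    rfl
  have hS := hasSum_integral_of_summable_integral_norm (F := fun k s => c k * G k s) (μ := μ)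
    (fun k => (hGint k).const_mul _) hsum2
  have hSle : (∫ s, ∑' k, c k * G k s ∂μ) ≤ 0 := by
    refine setIntegral_nonpos measurableSet_Ioo (fun s hs => ?_)
    have h1s : 0 < 1 - s := by linarith [hs.2]
    have e : ∀ k, c k * G k s = (1 - s) ^ (-ν - 1) *
        (c k - (-(x * s ^ ν)) ^ k / Real.Gamma (ν * k + 1)) := by
      intro k
      simp only [hc, hG]
      rw [Real.rpow_mul hs.1.le, Real.rpow_natCast, neg_mul_eq_neg_mul, mul_pow]
      ring
    simp_rw [e]
    rw [tsum_mul_left, hcs.tsum_sub (ml_summable h0 _)]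
    refine mul_nonpos_of_nonneg_of_nonpos (by positivity) ?_
    have hs1 := Real.rpow_le_one hs.1.le hs.2.le h0.le
    have hs0 := Real.rpow_nonneg hs.1.le ν
    have := hmin (x * s ^ ν) ⟨by positivity, by nlinarith⟩
    exact sub_nonpos.2 this
  have hS1 := ((hasSum_nat_add_iff' 1).2 hS).mul_left ν
  have hT : HasSum (fun j => -(x * Real.Gamma (1 - ν)) * c j - c (j + 1))
      (-(x * Real.Gamma (1 - ν)) * mittagLeffler ν (-x) - (mittagLeffler ν (-x) - 1)) := by
    refine (hcE.mul_left _).sub ?_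
    have := (hasSum_nat_add_iff' 1).2 hcE
    simpa [hc] using this
  have huniq := hT.unique (hS1.congr_fun ?_)
  · simp only [Finset.sum_range_one, hG0, mul_zero, integral_zero, sub_zero] at huniq
    nlinarith [mul_nonpos_of_nonneg_of_nonpos h0.le hSle]
  · intro j
    rw [← hterm]
    simp only [integral_const_mul]
    ring

lemma ml_continuous {ν : ℝ} (hν : 0 < ν) : Continuous (mittagLeffler ν) := by
  rw [continuous_iff_continuousAt]
  intro x
  have hon : ContinuousOn (mittagLeffler ν) (Set.Ioo (x - 1) (x + 1)) := by
    refine continuousOn_tsum (fun k => by fun_prop) (ml_summable_abs hν (|x| + 1)) ?_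
    intro k z hz
    rw [norm_div, norm_pow, Real.norm_eq_abs, Real.norm_of_nonneg (ml_gamma_pos hν k).le]
    refine div_le_div_of_nonneg_right ?_ (ml_gamma_pos hν k).le
    refine pow_le_pow_left₀ (abs_nonneg _) ?_ k
    rw [abs_of_nonneg (by positivity : 0 ≤ |x| + 1)]
    have h1 := le_abs_self x
    have h2 := neg_abs_le x
    rw [abs_le]; constructor <;> linarith [hz.1, hz.2]
  exact hon.continuousAt (Ioo_mem_nhds (by linarith) (by linarith))

lemma ml_neg_lower {ν x : ℝ} (hν : ν ∈ Set.Ioo (0 : ℝ) 1) (hx : 0 ≤ x) :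
    (1 + Real.Gamma (1 - ν) * x)⁻¹ ≤ mittagLeffler ν (-x) := by
  have hg : 0 < Real.Gamma (1 - ν) := Real.Gamma_pos_of_pos (by linarith [hν.2])
  have hcont : Continuous fun z => mittagLeffler ν (-z) := (ml_continuous hν.1).comp continuous_neg
  obtain ⟨x0, hx0, hm⟩ := isCompact_Icc.exists_isMinOn (Set.nonempty_Icc.2 hx) hcont.continuousOn
  have hxx : mittagLeffler ν (-x0) ≤ mittagLeffler ν (-x) := hm (Set.right_mem_Icc.2 hx)
  refine le_trans ?_ hxx
  have hpos : 0 < 1 + Real.Gamma (1 - ν) * x0 := by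
    have := mul_nonneg hg.le hx0.1; linarith
  have hle : (1 + Real.Gamma (1 - ν) * x)⁻¹ ≤ (1 + Real.Gamma (1 - ν) * x0)⁻¹ := by
    have := mul_le_mul_of_nonneg_left hx0.2 hg.le
    exact inv_anti₀ hpos (by linarith)
  refine hle.trans ?_
  rcases hx0.1.eq_or_lt with h | h
  · rw [← h]; simp [ml_zero]
  · have := ml_neg_of_min hν h (fun z hz => hm ⟨hz.1, hz.2.trans hx0.2⟩)
    rwa [inv_le_iff_one_le_mul₀ hpos]

/-- Uniform bound on the logarithm. -/
lemma ml_log_bound {ν : ℝ} (hν : ν ∈ Set.Ioo (0 : ℝ) 1) :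
    ∃ C > 0, ∀ x : ℝ, |Real.log (mittagLeffler ν x)| ≤ C * (1 + |x| ^ (1 / ν)) := by
  have h0 := hν.1
  have hg : 0 < Real.Gamma (1 - ν) := Real.Gamma_pos_of_pos (by linarith [hν.2])
  have h2 : (0:ℝ) < 2 ^ (1 / ν) := by positivity
  refine ⟨1 + 2 ^ (1 / ν) + Real.Gamma (1 - ν), by positivity, fun x => ?_⟩
  have hp : 0 ≤ |x| ^ (1 / ν) := by positivity
  have hxle : |x| ≤ 1 + |x| ^ (1 / ν) := by
    rcases le_total |x| 1 with h | h
    · linarith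
    · have := Real.rpow_le_rpow_of_exponent_le h (one_le_one_div h0 hν.2.le)
      rw [Real.rpow_one] at this
      linarith
  have hlow : Real.exp (-(Real.Gamma (1 - ν) * |x|)) ≤ mittagLeffler ν x := by
    rcases le_total 0 x with h | h
    · refine le_trans ?_ (ml_one_le h0 h)
      rw [Real.exp_le_one_iff]
      have : 0 ≤ Real.Gamma (1 - ν) * |x| := by positivity
      linarith
    · have := ml_neg_lower hν (x := -x) (by linarith)
      rw [neg_neg] at this
      refine le_trans ?_ this
      rw [abs_of_nonpos h, Real.exp_neg]
      have hq : 0 ≤ Real.Gamma (1 - ν) * -x := mul_nonneg hg.le (by linarith)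
      refine inv_anti₀ (by linarith) ?_
      linarith [Real.add_one_le_exp (Real.Gamma (1 - ν) * -x)]
  have hE : 0 < mittagLeffler ν x := (Real.exp_pos _).trans_le hlow
  have hl : -(Real.Gamma (1 - ν) * |x|) ≤ Real.log (mittagLeffler ν x) :=
    (Real.le_log_iff_exp_le hE).2 hlow
  have hu : Real.log (mittagLeffler ν x) ≤ 2 ^ (1 / ν) * |x| ^ (1 / ν) + 1 := by
    rw [Real.log_le_iff_le_exp hE]
    refine (ml_le_abs h0 x).trans ((ml_le h0 (abs_nonneg x) one_lt_two).trans ?_)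
    rw [Real.mul_rpow (by norm_num) (abs_nonneg x), Real.exp_add]
    refine mul_le_mul_of_nonneg_left ?_ (Real.exp_pos _).le
    have := Real.add_one_le_exp 1
    norm_num at this ⊢
    exact this
  have hm := mul_le_mul_of_nonneg_left hxle hg.le
  have hm2 : 0 ≤ Real.Gamma (1 - ν) * (1 + |x| ^ (1 / ν)) := by positivity
  have hm3 := mul_nonneg h2.le hp
  rw [abs_le]
  constructor
  · nlinarith
  · nlinarith

lemma ml_log_tendsto {ν : ℝ} (hν : ν ∈ Set.Ioo (0 : ℝ) 1) :
    Tendsto (fun y : ℝ => Real.log (mittagLeffler ν (y ^ ν)) / y) atTop (nhds 1) := by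
  have h0 := hν.1
  rw [tendsto_order]
  constructor
  · intro b hb
    have hlim : Tendsto (fun y : ℝ => 1 - Real.log 2 / y - Real.log y / y) atTop (nhds 1) := by
      have t1 : Tendsto (fun y : ℝ => Real.log 2 / y) atTop (nhds 0) :=
        tendsto_const_nhds.div_atTop tendsto_id
      have t2 : Tendsto (fun y : ℝ => Real.log y / y) atTop (nhds 0) := by
        simpa using Real.isLittleO_log_id_atTop.tendsto_div_nhds_zero
      simpa using (tendsto_const_nhds.sub t1).sub t2
    filter_upwards [hlim.eventually (lt_mem_nhds hb), eventually_ge_atTop 1] with y hy hy1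
    refine hy.trans_le ?_
    have hy0 : 0 < y := by linarith
    have hl := ml_lower hν hy1
    have he : Real.exp y / (2 * y) ≤ mittagLeffler ν (y ^ ν) := by
      rw [div_le_iff₀ (by positivity)]
      linarith [Real.add_one_le_exp y]
    have := Real.log_le_log (by positivity) he
    rw [Real.log_div (Real.exp_pos _).ne' (by positivity), Real.log_exp,
      Real.log_mul two_ne_zero hy0.ne'] at this
    rw [le_div_iff₀ hy0]
    have e : (1 - Real.log 2 / y - Real.log y / y) * y = y - (Real.log 2 + Real.log y) := by
      field_simp; ring
    rw [e]; exact this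
  · intro b hb
    set m := (1 + b) / 2 with hm
    have hm1 : 1 < m := by rw [hm]; linarith
    have hmb : m < b := by rw [hm]; linarith
    have hr : 1 < m ^ ν := Real.one_lt_rpow hm1 h0
    set D := (1 - (m ^ ν)⁻¹)⁻¹ with hD
    have hDpos : 0 < D := inv_pos.2 (sub_pos.2 (inv_lt_one_of_one_lt₀ hr))
    have hlim : Tendsto (fun y : ℝ => m + Real.log D / y) atTop (nhds m) := by
      have t1 : Tendsto (fun y : ℝ => Real.log D / y) atTop (nhds 0) :=
        tendsto_const_nhds.div_atTop tendsto_id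
      simpa using tendsto_const_nhds.add t1
    filter_upwards [hlim.eventually (gt_mem_nhds hmb), eventually_ge_atTop 1] with y hy hy1
    refine lt_of_le_of_lt ?_ hy
    have hy0 : 0 < y := by linarith
    have hyν : 0 ≤ y ^ ν := by positivity
    have h := ml_le h0 hyν hr
    rw [← Real.mul_rpow (by linarith) hy0.le, ← Real.rpow_mul (by positivity),
      mul_one_div_cancel h0.ne', Real.rpow_one, ← hD] at h
    have := Real.log_le_log (by linarith [ml_one_le h0 hyν]) h
    rw [Real.log_mul (Real.exp_pos _).ne' hDpos.ne', Real.log_exp] at this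
    rw [div_le_iff₀ hy0]
    have e : (m + Real.log D / y) * y = m * y + Real.log D := by field_simp
    rw [e]; exact this

/-- Gärtner–Ellis limit for the noncentral moderate deviations of a time-changed
Lévy process in the case `∇κ_S(0) = 0`: if `κ : ℝ^h → ℝ` is twice continuously
differentiable near the origin with `κ(0) = 0`, zero gradient at `0` and Hessian
matrix `Q` at `0` (expressed via the second-order Taylor expansion), where `Q` is
positive semidefinite and not null, then for any positive scalings `a_t → 0` with
`t·a_t → ∞` and any `θ ∈ ℝ^h`,
`a_t log E_ν(κ((a_t t)^{-ν/2} θ) t^ν) → (⟨θ, Qθ⟩/2)^{1/ν}` as `t → ∞`. -/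
theorem gartnerEllis_limit_timeChanged_gradient_zero
    {h : ℕ} {ν : ℝ} (hν : ν ∈ Set.Ioo (0 : ℝ) 1)
    (κ : (Fin h → ℝ) → ℝ) (Q : Matrix (Fin h) (Fin h) ℝ)
    (hC2 : ContDiffAt ℝ 2 κ 0) (hκ0 : κ 0 = 0)
    (hgrad : fderiv ℝ κ 0 = 0)
    (hTaylor : (fun u : Fin h → ℝ => κ u - dotProduct u (Q.mulVec u) / 2)
        =o[nhds 0] fun u => ‖u‖ ^ 2)
    (hQ : Q.PosSemidef) (hQne : Q ≠ 0)
    (a : ℝ → ℝ) (ha_pos : ∀ t > 0, 0 < a t)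
    (ha0 : Tendsto a atTop (nhds 0))
    (hta : Tendsto (fun t => t * a t) atTop atTop)
    (θ : Fin h → ℝ) :
    Tendsto (fun t : ℝ =>
        a t * Real.log (mittagLeffler ν (κ ((a t * t) ^ (-(ν / 2)) • θ) * t ^ ν)))
      atTop (nhds ((dotProduct θ (Q.mulVec θ) / 2) ^ (1 / ν))) := by
 
  have h0 := hν.1
  set q := dotProduct θ (Q.mulVec θ) / 2 with hq
  have hq0 : 0 ≤ q := by
    have := hQ.dotProduct_mulVec_nonneg θ
    simp only [star_trivial] at this
    rw [hq]; linarith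
  have hb : Tendsto (fun t => a t * t) atTop atTop := hta.congr fun t => mul_comm _ _
  have hbpos : ∀ᶠ t in atTop, 0 < a t * t := hb.eventually_gt_atTop 0
  have hscal : Tendsto (fun t => (a t * t) ^ (-(ν / 2))) atTop (nhds 0) :=
    (tendsto_rpow_neg_atTop (half_pos h0)).comp hb
  have hu : Tendsto (fun t => (a t * t) ^ (-(ν / 2)) • θ) atTop (nhds 0) := by
    simpa using hscal.smul_const θ
  have hsq : ∀ b : ℝ, 0 < b → (b ^ (-(ν / 2))) * (b ^ (-(ν / 2))) * b ^ ν = 1 := by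
    intro b hb
    rw [← Real.rpow_add hb, ← Real.rpow_add hb]
    rw [show -(ν / 2) + -(ν / 2) + ν = 0 by ring, Real.rpow_zero]
  set w : ℝ → ℝ := fun t => κ ((a t * t) ^ (-(ν / 2)) • θ) * (a t * t) ^ ν with hw
  have hwlim : Tendsto w atTop (nhds q) := by
    have hlo := hTaylor.comp_tendsto hu
    have hlo2 := hlo.mul_isBigO (Asymptotics.isBigO_refl (fun t => (a t * t) ^ ν) atTop)
    have hlo3 : (fun t => w t - q) =o[atTop] fun _ => ‖θ‖ ^ 2 := by
      refine hlo2.congr' ?_ ?_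
      · filter_upwards [hbpos] with t ht
        have e := hsq _ ht
        simp only [Function.comp_def, Matrix.mulVec_smul, smul_dotProduct, dotProduct_smul,
          smul_eq_mul, hw, hq]
        linear_combination (-(θ ⬝ᵥ Q *ᵥ θ) / 2) * e
      · filter_upwards [hbpos] with t ht
        have e := hsq _ ht
        have hp : 0 < (a t * t) ^ (-(ν / 2)) := Real.rpow_pos_of_pos ht _
        simp only [Function.comp_def, norm_smul, Real.norm_of_nonneg hp.le]
        linear_combination (‖θ‖ ^ 2) * e
    have h4 : Tendsto (fun t => w t - q) atTop (nhds 0) := by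
      have h5 : (fun t => w t - q) =o[atTop] fun _ => (1 : ℝ) :=
        hlo3.trans_isBigO (Asymptotics.isBigO_const_const _ one_ne_zero _)
      exact (Asymptotics.isLittleO_one_iff ℝ).1 h5
    simpa using h4.add_const q
  have hx : ∀ᶠ t in atTop, κ ((a t * t) ^ (-(ν / 2)) • θ) * t ^ ν = w t * ((a t)⁻¹) ^ ν := by
    filter_upwards [eventually_gt_atTop 0] with t ht
    have hat := ha_pos t ht
    simp only [hw]
    rw [Real.mul_rpow (z := ν) hat.le ht.le, Real.inv_rpow hat.le]
    have := (Real.rpow_pos_of_pos hat ν).ne'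
    field_simp
  have hwp : Tendsto (fun t => |w t| ^ (1 / ν)) atTop (nhds (q ^ (1 / ν))) := by
    have := hwlim.abs.rpow_const (p := 1 / ν) (Or.inr (by positivity))
    rwa [abs_of_nonneg hq0] at this
  have hpow : ∀ t, 0 < a t → (|w t| * ((a t)⁻¹) ^ ν) ^ (1 / ν) = |w t| ^ (1 / ν) * (a t)⁻¹ := by
    intro t hat
    rw [Real.mul_rpow (abs_nonneg _) (by positivity), ← Real.rpow_mul (by positivity),
      mul_one_div_cancel h0.ne', Real.rpow_one]
  rcases hq0.eq_or_lt with hqz | hqp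
  · rw [← hqz, Real.zero_rpow (by positivity)]
    rw [← hqz, Real.zero_rpow (by positivity)] at hwp
    obtain ⟨C, hC, hbd⟩ := ml_log_bound hν
    have hlim : Tendsto (fun t => C * (a t + |w t| ^ (1 / ν))) atTop (nhds 0) := by
      simpa using (ha0.add hwp).const_mul C
    refine squeeze_zero_norm' ?_ hlim
    filter_upwards [hx, eventually_gt_atTop 0] with t hxt ht
    have hat := ha_pos t ht
    rw [hxt, norm_mul, Real.norm_of_nonneg hat.le, Real.norm_eq_abs]
    refine (mul_le_mul_of_nonneg_left (hbd _) hat.le).trans (le_of_eq ?_)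
    have hn : 0 ≤ ((a t)⁻¹) ^ ν := by positivity
    rw [abs_mul, abs_of_nonneg hn, hpow t hat]
    field_simp
  · have hainv : Tendsto (fun t => (a t)⁻¹) atTop atTop := by
      refine tendsto_inv_nhdsGT_zero.comp (tendsto_nhdsWithin_iff.2 ⟨ha0, ?_⟩)
      filter_upwards [eventually_gt_atTop 0] with t ht using ha_pos t ht
    have hy : Tendsto (fun t => |w t| ^ (1 / ν) * (a t)⁻¹) atTop atTop :=
      hwp.pos_mul_atTop (Real.rpow_pos_of_pos hqp _) hainv
    have hmain := hwp.mul ((ml_log_tendsto hν).comp hy)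
    rw [mul_one] at hmain
    refine hmain.congr' ?_
    filter_upwards [hx, eventually_gt_atTop 0, hwlim.eventually (lt_mem_nhds hqp)]
      with t hxt ht hwt
    have hat := ha_pos t ht
    have hP : 0 < |w t| ^ (1 / ν) := by
      rw [abs_of_pos hwt]; positivity
    have e : (|w t| ^ (1 / ν) * (a t)⁻¹) ^ ν = w t * ((a t)⁻¹) ^ ν := by
      rw [Real.mul_rpow hP.le (by positivity), ← Real.rpow_mul (abs_nonneg _),
        one_div_mul_cancel h0.ne', Real.rpow_one, abs_of_pos hwt]
    simp only [Function.comp_def]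
    rw [e, hxt]
    field_simp
end

section
/- Let ν ∈ (0,1), let E_ν be the Mittag-Leffler function, and let κ : ℝ^h → ℝ be differentiable on a neighborhood of the origin with κ(0) = 0 and m := ∇κ(0) ≠ 0. Let (a_t)_{t>0} be positive numbers with a_t → 0 and t·a_t → ∞ as t → ∞. Then for every θ ∈ ℝ^h, lim_{t→∞} a_t · log E_ν( κ( (a_t t)^{−ν} θ ) · t^ν ) = ( ⟨θ, m⟩ )^{1/ν} if ⟨θ, m⟩ ≥ 0, and the limit equals 0 if ⟨θ, m⟩ < 0. (This is the Gärtner–Ellis limit underlying the noncentral moderate deviation principle for time-changed Lévy processes when ∇κ_S(0) ≠ 0.) -/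
open Filter Matrix

/-- Coefficients of `(1 - z)^(-s)`. -/
noncomputable def negBinCoeff (s : ℝ) (n : ℕ) : ℝ := ∏ j ∈ Finset.range n, (s + j) / (j + 1)

lemma negBinCoeff_eq (s : ℝ) (n : ℕ) :
    negBinCoeff s n = (-1 : ℝ) ^ n * Ring.choose (-s) n := by
  rw [Ring.choose_neg, ← Ring.multichoose_eq]
  have h := Ring.factorial_nsmul_multichoose_eq_ascPochhammer s n
  rw [Polynomial.ascPochhammer_smeval_eq_eval] at h
  have h2 : (n.factorial : ℝ) * negBinCoeff s n = (ascPochhammer ℝ n).eval s := by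
    clear h
    induction n with
    | zero => simp [negBinCoeff]
    | succ n ih =>
      rw [ascPochhammer_succ_eval, ← ih, negBinCoeff, negBinCoeff, Finset.prod_range_succ,
        Nat.factorial_succ]
      push_cast
      field_simp
  have h3 : negBinCoeff s n = Ring.multichoose s n := by
    rw [nsmul_eq_mul, ← h2] at h
    exact (mul_left_cancel₀ (by positivity) h).symm
  rw [h3, Units.smul_def, zsmul_eq_mul]
  rw [Int.cast_negOnePow_natCast, ← mul_assoc, ← mul_pow]
  simp

lemma negBinCoeff_conv (s t : ℝ) (n : ℕ) :
    ∑ ij ∈ Finset.HasAntidiagonal.antidiagonal n, negBinCoeff s ij.1 * negBinCoeff t ij.2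
      = negBinCoeff (s + t) n := by
  rw [negBinCoeff_eq, neg_add, Ring.add_choose_eq n (Commute.all _ _), Finset.mul_sum]
  refine Finset.sum_congr rfl fun ij hij => ?_
  rw [negBinCoeff_eq, negBinCoeff_eq, ← Finset.HasAntidiagonal.mem_antidiagonal.1 hij, pow_add]
  ring

lemma negBinCoeff_one (n : ℕ) : negBinCoeff 1 n = 1 := by
  refine Finset.prod_eq_one fun j _ => ?_
  rw [add_comm]; exact div_self (by positivity)

lemma negBinCoeff_zero (s : ℝ) : negBinCoeff s 0 = 1 := by simp [negBinCoeff]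

lemma negBinCoeff_nonneg {s : ℝ} (hs : 0 ≤ s) (n : ℕ) : 0 ≤ negBinCoeff s n :=
  Finset.prod_nonneg fun j _ => by positivity

lemma negBinCoeff_neg_nonpos {ν : ℝ} (h0 : 0 < ν) (h1 : ν < 1) (n : ℕ) :
    negBinCoeff (-ν) (n + 1) ≤ 0 := by
  rw [negBinCoeff, Finset.prod_range_succ']
  refine mul_nonpos_of_nonneg_of_nonpos (Finset.prod_nonneg fun j _ => ?_) (by simp; exact h0.le)
  apply div_nonneg _ (by positivity)
  push_cast
  have : (0 : ℝ) ≤ j := by positivity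
  linarith

lemma negBinCoeff_le {K : ℝ} (hK : 0 ≤ K) (n : ℕ) :
    negBinCoeff (1 + K) n ≤ (1 + K) ^ n := by
  rw [negBinCoeff]
  calc _ ≤ ∏ j ∈ Finset.range n, (1 + K) := by
        refine Finset.prod_le_prod (fun j _ => by positivity) fun j _ => ?_
        have : (0 : ℝ) ≤ j := by positivity
        rw [div_le_iff₀ (by positivity)]
        nlinarith [mul_nonneg hK this]
    _ = _ := by simp

lemma negBinCoeff_le' {K : ℝ} (hK : 0 ≤ K) (J : ℕ) (hJ : 0 < J) (n : ℕ) (hn : J ≤ n) :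
    negBinCoeff (1 + K) n ≤ (1 + K) ^ J * ((n : ℝ) / J) ^ K := by
  induction n, hn using Nat.le_induction with
  | base => 
    rw [div_self (by positivity), Real.one_rpow, mul_one]; exact negBinCoeff_le hK J
  | succ n hn ih =>
    have hn0 : (0 : ℝ) < n := by exact_mod_cast (by omega : 0 < n)
    have hJ0 : (0 : ℝ) < J := by exact_mod_cast hJ
    have e : negBinCoeff (1 + K) (n + 1) = negBinCoeff (1 + K) n * ((1 + K + n) / (n + 1)) := by
      rw [negBinCoeff, negBinCoeff, Finset.prod_range_succ]
    have key : (1 + K + n) / (n + 1) ≤ (((n + 1 : ℕ) : ℝ) / n) ^ K := by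
      push_cast
      have h1 : (1 + K + n) / (n + 1) = K / (n + 1) + 1 := by field_simp; ring
      have h2 : 1 / ((n : ℝ) + 1) ≤ Real.log ((n + 1) / n) := by
        have := Real.one_sub_inv_le_log_of_pos (x := ((n : ℝ) + 1) / n) (by positivity)
        refine le_trans (le_of_eq ?_) this
        field_simp; ring
      rw [h1, Real.rpow_def_of_pos (by positivity)]
      refine (Real.add_one_le_exp _).trans (Real.exp_le_exp.2 ?_)
      calc K / (n + 1) = K * (1 / (n + 1)) := by ring
        _ ≤ K * Real.log ((n + 1) / n) := by gcongr
        _ = _ := by ring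
    rw [e]
    calc _ ≤ ((1 + K) ^ J * ((n : ℝ) / J) ^ K) * (((n + 1 : ℕ) : ℝ) / n) ^ K := by
          gcongr
      _ = _ := by
          rw [mul_assoc, ← Real.mul_rpow (by positivity) (by positivity)]
          congr 2
          field_simp

lemma negBinCoeff_tendsto {K : ℝ} (hK : 0 ≤ K) :
    Tendsto (fun n : ℕ => negBinCoeff (1 + K) n * ((n : ℝ) ^ K)⁻¹) atTop
      (nhds (1 / Real.Gamma (K + 1))) := by
  rcases hK.eq_or_lt with rfl | hK
  · simp [negBinCoeff_one]
  rw [Real.Gamma_add_one hK.ne']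
  have h := ((Real.GammaSeq_tendsto_Gamma K).const_mul K).inv₀
    (mul_ne_zero hK.ne' (Real.Gamma_pos_of_pos hK).ne')
  rw [one_div]
  refine h.congr' ?_
  filter_upwards [eventually_gt_atTop 0] with n hn
  have hn0 : (0 : ℝ) < n := by exact_mod_cast hn
  have e : negBinCoeff (1 + K) n * n.factorial = ∏ j ∈ Finset.range n, (K + ((j + 1 : ℕ) : ℝ)) := by
    rw [negBinCoeff, Finset.prod_div_distrib, ← Finset.prod_range_add_one_eq_factorial]
    push_cast
    rw [div_mul_cancel₀]
    · refine Finset.prod_congr rfl fun j _ => by ring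
    · exact Finset.prod_ne_zero_iff.2 fun j _ => by positivity
  rw [Real.GammaSeq, Finset.prod_range_succ', ← e]
  have hf : (0 : ℝ) < n.factorial := by positivity
  have hr : (0 : ℝ) < (n : ℝ) ^ K := by positivity
  have hc : 0 < negBinCoeff (1 + K) n := Finset.prod_pos fun j _ => by positivity
  simp only [Nat.cast_zero, add_zero]
  field_simp

lemma summable_poly_geom {ν r : ℝ} (hr : |r| < 1) (J : ℕ) :
    Summable (fun k : ℕ => (1 + ν * k) ^ J * r ^ k) := by
  have : ∀ k : ℕ, (1 + ν * k) ^ J * r ^ k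
      = ∑ i ∈ Finset.range (J + 1), (ν ^ (J - i) * J.choose i) * ((k : ℝ) ^ (J - i) * r ^ k) := by
    intro k
    rw [add_pow, Finset.sum_mul]
    refine Finset.sum_congr rfl fun i _ => ?_
    rw [mul_pow]; ring
  simp_rw [this]
  refine summable_sum fun i _ => Summable.mul_left _ ?_
  exact summable_pow_mul_geometric_of_norm_lt_one (R := ℝ) (J - i) (r := r) hr

/-- discrete analogue of the Mittag-Leffler function at `-λ`. -/
noncomputable def discML (ν l : ℝ) (n : ℕ) : ℝ := ∑' k : ℕ, (-l) ^ k * negBinCoeff (1 + ν * k) n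

lemma discML_summable {ν l : ℝ} (h0 : 0 < ν) (hl0 : 0 ≤ l) (hl : l < 1) (n : ℕ) :
    Summable (fun k : ℕ => (-l) ^ k * negBinCoeff (1 + ν * k) n) := by
  refine Summable.of_norm_bounded
    (summable_poly_geom (ν := ν) (r := l) (by rw [abs_of_nonneg hl0]; exact hl) n) fun k => ?_
  rw [norm_mul, norm_pow, norm_neg, Real.norm_of_nonneg hl0,
    Real.norm_of_nonneg (negBinCoeff_nonneg (by positivity) n), mul_comm]
  gcongr
  exact negBinCoeff_le (by positivity) n

lemma discML_zero {ν l : ℝ} (hl0 : 0 ≤ l) (hl : l < 1) :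
    (1 + l) * discML ν l 0 = 1 := by
  simp only [discML, negBinCoeff_zero, mul_one]
  rw [tsum_geometric_of_abs_lt_one (by rw [abs_neg, abs_of_nonneg hl0]; exact hl)]
  rw [sub_neg_eq_add, mul_inv_cancel₀ (by positivity)]

lemma discML_rec {ν l : ℝ} (h0 : 0 < ν) (hl0 : 0 ≤ l) (hl : l < 1) (n : ℕ) :
    (1 + l) * discML ν l (n + 1) = negBinCoeff (1 - ν) (n + 1) +
      ∑ ij ∈ Finset.HasAntidiagonal.antidiagonal n, (-negBinCoeff (-ν) (ij.1 + 1)) * discML ν l ij.2 := by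
  have h := fun n => discML_summable h0 hl0 hl n
  have e1 : ∑ ij ∈ Finset.HasAntidiagonal.antidiagonal (n + 1), negBinCoeff (-ν) ij.1 * discML ν l ij.2
      = negBinCoeff (1 - ν) (n + 1) - l * discML ν l (n + 1) := by
    have a1 : ∑ ij ∈ Finset.HasAntidiagonal.antidiagonal (n + 1), negBinCoeff (-ν) ij.1 * discML ν l ij.2
        = ∑' k : ℕ, (-l) ^ k * negBinCoeff (1 + ν * k - ν) (n + 1) := by
      have hs : ∀ ij ∈ Finset.HasAntidiagonal.antidiagonal (n + 1), Summable (fun k : ℕ =>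
          negBinCoeff (-ν) ij.1 * ((-l) ^ k * negBinCoeff (1 + ν * k) ij.2)) :=
        fun ij _ => Summable.mul_left (negBinCoeff (-ν) ij.1) (h ij.2)
      have hs2 := Summable.tsum_finsetSum hs
      simp only [discML, ← tsum_mul_left]
      rw [← hs2]
      refine tsum_congr fun k => ?_
      rw [show 1 + ν * (k : ℝ) - ν = -ν + (1 + ν * k) by ring, ← negBinCoeff_conv, Finset.mul_sum]
      refine Finset.sum_congr rfl fun ij _ => by ring
    have a2 : ∀ k : ℕ, (-l) ^ (k + 1) * negBinCoeff (1 + ν * ((k + 1 : ℕ) : ℝ) - ν) (n + 1)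
        = (-l) * ((-l) ^ k * negBinCoeff (1 + ν * k) (n + 1)) := by
      intro k
      rw [show 1 + ν * ((k + 1 : ℕ) : ℝ) - ν = 1 + ν * k by push_cast; ring]
      ring
    rw [a1, Summable.tsum_eq_zero_add]
    · simp_rw [a2]
      rw [tsum_mul_left, discML]; simp; ring
    · rw [← summable_nat_add_iff 1]
      simp_rw [a2]
      exact (h _).mul_left _
  rw [Finset.Nat.sum_antidiagonal_succ, negBinCoeff_zero] at e1
  simp only [neg_mul, Finset.sum_neg_distrib]
  linarith

lemma discML_bounds {ν l : ℝ} (h0 : 0 < ν) (h1 : ν < 1) (hl0 : 0 ≤ l) (hl : l < 1) (n : ℕ) :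
    Real.exp (-(Real.log (1 + l) * negBinCoeff (1 + ν) n)) ≤ discML ν l n ∧ discML ν l n ≤ 1 := by
  induction n using Nat.strong_induction_on with
  | _ n ih =>
  have hexp : Real.exp (Real.log (1 + l)) = 1 + l := Real.exp_log (by positivity)
  rcases n with _ | n
  · have := discML_zero (ν := ν) hl0 hl
    have e : discML ν l 0 = (1 + l)⁻¹ := eq_inv_of_mul_eq_one_right this
    rw [negBinCoeff_zero, mul_one, Real.exp_neg, hexp, e]
    exact ⟨le_rfl, inv_le_one_of_one_le₀ (by linarith)⟩
  · have hr := discML_rec h0 hl0 hl n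
    have hp : ∀ i, 0 ≤ -negBinCoeff (-ν) (i + 1) := fun i => by
      have := negBinCoeff_neg_nonpos h0 h1 i; linarith
    have hw := negBinCoeff_conv (-ν) 1 (n + 1)
    have hH := negBinCoeff_conv (-ν) (1 + ν) (n + 1)
    rw [Finset.Nat.sum_antidiagonal_succ, negBinCoeff_zero] at hw hH
    rw [show -ν + (1 + ν) = 1 by ring] at hH
    rw [show -ν + 1 = 1 - ν by ring] at hw
    simp only [negBinCoeff_one, mul_one] at hw hH
    have hr0 : 0 ≤ negBinCoeff (1 - ν) (n + 1) := negBinCoeff_nonneg (by linarith) _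
    have hlt : ∀ ij ∈ Finset.HasAntidiagonal.antidiagonal n, ij.2 < n + 1 := fun ij hij => by
      have := Finset.HasAntidiagonal.mem_antidiagonal.1 hij; omega
    constructor
    · set L := Real.log (1 + l) with hL
      set M := L * (negBinCoeff (1 + ν) (n + 1) - 1) with hM
      have t : ∀ x : ℝ, Real.exp (-M) * (1 + M - x) ≤ Real.exp (-x) := fun x => by
        have := Real.add_one_le_exp (M - x)
        calc _ ≤ Real.exp (-M) * Real.exp (M - x) := by gcongr; linarith
          _ = _ := by rw [← Real.exp_add]; congr 1; ring
      have s1 : Real.exp (-M) ≤ (1 + l) * discML ν l (n + 1) := by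
        rw [hr]
        have t0 := t 0
        simp only [sub_zero, neg_zero, Real.exp_zero] at t0
        calc Real.exp (-M) = negBinCoeff (1 - ν) (n + 1) * (Real.exp (-M) * (1 + M)) +
              ∑ ij ∈ Finset.HasAntidiagonal.antidiagonal n, (-negBinCoeff (-ν) (ij.1 + 1)) *
                (Real.exp (-M) * (1 + M - L * negBinCoeff (1 + ν) ij.2)) := by
              have : ∑ ij ∈ Finset.HasAntidiagonal.antidiagonal n, (-negBinCoeff (-ν) (ij.1 + 1)) *
                (Real.exp (-M) * (1 + M - L * negBinCoeff (1 + ν) ij.2))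
                = -(Real.exp (-M) * (1 + M)) *
                    ∑ ij ∈ Finset.HasAntidiagonal.antidiagonal n, negBinCoeff (-ν) (ij.1 + 1)
                  + Real.exp (-M) * L * ∑ ij ∈ Finset.HasAntidiagonal.antidiagonal n,
                    negBinCoeff (-ν) (ij.1 + 1) * negBinCoeff (1 + ν) ij.2 := by
                rw [Finset.mul_sum, Finset.mul_sum, ← Finset.sum_add_distrib]
                refine Finset.sum_congr rfl fun ij _ => by ring
              rw [this, ← hw, ← sub_eq_of_eq_add' hH.symm, hM]
              ring
          _ ≤ negBinCoeff (1 - ν) (n + 1) * 1 + _ := by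
              refine add_le_add (mul_le_mul_of_nonneg_left t0 hr0)
                (Finset.sum_le_sum fun ij hij => mul_le_mul_of_nonneg_left
                  ((t _).trans (ih ij.2 (hlt ij hij)).1) (hp _))
          _ = _ := by rw [mul_one]
      have : Real.exp (-(L * negBinCoeff (1 + ν) (n + 1))) * (1 + l) = Real.exp (-M) := by
        rw [← hexp, ← Real.exp_add]; congr 1; rw [hM]; ring
      rw [← this, mul_comm] at s1
      exact le_of_mul_le_mul_left s1 (by positivity)
    · have hs : ∑ ij ∈ Finset.HasAntidiagonal.antidiagonal n, (-negBinCoeff (-ν) (ij.1 + 1)) * discML ν l ij.2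
          ≤ ∑ ij ∈ Finset.HasAntidiagonal.antidiagonal n, (-negBinCoeff (-ν) (ij.1 + 1)) :=
        Finset.sum_le_sum fun ij hij =>
          mul_le_of_le_one_right (hp _) (ih ij.2 (hlt ij hij)).2
      rw [Finset.sum_neg_distrib] at hs
      have hpos : (1 + l) * discML ν l (n + 1) ≤ (1 + l) * 1 := by rw [hr]; linarith
      exact le_of_mul_le_mul_left hpos (by positivity)

lemma discML_tendsto {ν x : ℝ} (h0 : 0 < ν) (hx : 0 ≤ x) :
    Tendsto (fun n : ℕ => discML ν (x * ((n : ℝ) ^ ν)⁻¹) n) atTop (nhds (mittagLeffler ν (-x))) := by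
  obtain ⟨J, hJ0, hJ⟩ : ∃ J : ℕ, 0 < J ∧ x * ((J : ℝ) ^ ν)⁻¹ < 1 := by
    have : Tendsto (fun n : ℕ => x * ((n : ℝ) ^ ν)⁻¹) atTop (nhds (x * 0)) :=
      (((tendsto_rpow_atTop h0).comp tendsto_natCast_atTop_atTop).inv_tendsto_atTop).const_mul x
    rw [mul_zero] at this
    exact ((eventually_gt_atTop 0).and (this.eventually_lt_const one_pos)).exists
  have hJp : (0 : ℝ) < J := by exact_mod_cast hJ0
  refine tendsto_tsum_of_dominated_convergence
    (summable_poly_geom (ν := ν) (r := x * ((J : ℝ) ^ ν)⁻¹)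
      (by rw [abs_of_nonneg (by positivity)]; exact hJ) J) (fun k => ?_) ?_
  · have := (negBinCoeff_tendsto (K := ν * k) (by positivity)).const_mul ((-x) ^ k)
    rw [mul_one_div] at this
    refine this.congr fun n => ?_
    rw [Real.rpow_mul (by positivity), Real.rpow_natCast, ← neg_mul, mul_pow, inv_pow]
    ring
  · filter_upwards [eventually_ge_atTop J] with n hn k
    have hn0 : (0 : ℝ) < n := by exact_mod_cast (by omega : 0 < n)
    have hb := negBinCoeff_le' (K := ν * k) (by positivity) J hJ0 n hn
    rw [norm_mul, norm_pow, norm_neg, Real.norm_of_nonneg (by positivity),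
      Real.norm_of_nonneg (negBinCoeff_nonneg (by positivity) n)]
    calc _ ≤ (x * ((n : ℝ) ^ ν)⁻¹) ^ k * ((1 + ν * k) ^ J * ((n : ℝ) / J) ^ (ν * k)) := by gcongr
      _ = _ := by
        rw [Real.rpow_mul (by positivity), Real.rpow_natCast,
          Real.div_rpow hn0.le hJp.le, div_pow, mul_pow, mul_pow, inv_pow, inv_pow]
        have : (0 : ℝ) < (n : ℝ) ^ ν := by positivity
        have : (0 : ℝ) < (J : ℝ) ^ ν := by positivity
        field_simp

lemma mittagLeffler_neg_bounds {ν x : ℝ} (h0 : 0 < ν) (h1 : ν < 1) (hx : 0 ≤ x) :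
    Real.exp (-(x * (1 / Real.Gamma (ν + 1)))) ≤ mittagLeffler ν (-x)
      ∧ mittagLeffler ν (-x) ≤ 1 := by
  have ht := discML_tendsto h0 hx
  have hev : ∀ᶠ n : ℕ in atTop, x * ((n : ℝ) ^ ν)⁻¹ < 1 := by
    have : Tendsto (fun n : ℕ => x * ((n : ℝ) ^ ν)⁻¹) atTop (nhds (x * 0)) :=
      (((tendsto_rpow_atTop h0).comp tendsto_natCast_atTop_atTop).inv_tendsto_atTop).const_mul x
    rw [mul_zero] at this
    exact this.eventually_lt_const one_pos
  constructor
  · have h2 : Tendsto (fun n : ℕ => Real.exp (-(x * (negBinCoeff (1 + ν) n * ((n : ℝ) ^ ν)⁻¹))))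
        atTop (nhds (Real.exp (-(x * (1 / Real.Gamma (ν + 1)))))) :=
      (Real.continuous_exp.tendsto _).comp ((negBinCoeff_tendsto h0.le).const_mul x).neg
    refine le_of_tendsto_of_tendsto h2 ht ?_
    filter_upwards [hev] with n hn
    refine le_trans ?_ (discML_bounds h0 h1 (by positivity) hn n).1
    refine Real.exp_le_exp.2 (neg_le_neg ?_)
    have hlog := Real.log_le_sub_one_of_pos (x := 1 + x * ((n : ℝ) ^ ν)⁻¹) (by positivity)
    have hc := negBinCoeff_nonneg (s := 1 + ν) (by positivity) n
    calc _ ≤ (x * ((n : ℝ) ^ ν)⁻¹) * negBinCoeff (1 + ν) n := by gcongr; linarith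
      _ = _ := by ring
  · refine le_of_tendsto ht ?_
    filter_upwards [hev] with n hn
    exact (discML_bounds h0 h1 (by positivity) hn n).2

lemma rpow_le_Gamma_mul_exp {s T : ℝ} (hs : 0 ≤ s) (hT : 0 ≤ T) :
    T ^ s * Real.exp (-T) ≤ Real.Gamma (s + 1) := by
  have hint := Real.GammaIntegral_convergent (s := s + 1) (by positivity)
  rw [Real.Gamma_eq_integral (by positivity)]
  have hsub : Set.Ioi T ⊆ Set.Ioi 0 := Set.Ioi_subset_Ioi hT
  calc T ^ s * Real.exp (-T) = ∫ r in Set.Ioi T, T ^ s * Real.exp (-r) := by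
        rw [MeasureTheory.integral_const_mul, integral_exp_neg_Ioi]
    _ ≤ ∫ r in Set.Ioi T, Real.exp (-r) * r ^ (s + 1 - 1) := by
        refine MeasureTheory.setIntegral_mono_on ?_ (hint.mono_set hsub) measurableSet_Ioi ?_
        · exact (integrableOn_exp_neg_Ioi T).const_mul _
        · intro r hr
          rw [mul_comm, add_sub_cancel_right]
          gcongr
          exact (Set.mem_Ioi.1 hr).le
    _ ≤ _ := by
        refine MeasureTheory.setIntegral_mono_set hint ?_ (hsub.eventuallyLE)
        filter_upwards [MeasureTheory.ae_restrict_mem measurableSet_Ioi] with r hr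
        have : 0 < r := hr
        simp only [Pi.zero_apply]
        positivity

lemma mittagLeffler_term_le {ν x A : ℝ} (h0 : 0 < ν) (hx : 0 ≤ x) (hA : 0 < A) (k : ℕ) :
    x ^ k / Real.Gamma (ν * k + 1) ≤ Real.exp A * (x / A ^ ν) ^ k := by
  have hG := rpow_le_Gamma_mul_exp (s := ν * k) (T := A) (by positivity) hA.le
  have hAn : 0 < A ^ ν := by positivity
  rw [Real.rpow_mul hA.le, Real.rpow_natCast] at hG
  calc _ ≤ x ^ k / ((A ^ ν) ^ k * Real.exp (-A)) := by gcongr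
    _ = _ := by rw [Real.exp_neg, div_pow]; field_simp

lemma mittagLeffler_summable {ν x : ℝ} (h0 : 0 < ν) (hx : 0 ≤ x) :
    Summable (fun k : ℕ => x ^ k / Real.Gamma (ν * k + 1)) := by
  have hA : (0 : ℝ) < (x + 1) ^ (1 / ν) := by positivity
  refine Summable.of_nonneg_of_le (fun k => ?_) (fun k => mittagLeffler_term_le h0 hx hA k) ?_
  · have := Real.Gamma_pos_of_pos (s := ν * k + 1) (by positivity)
    positivity
  · refine Summable.mul_left _ (summable_geometric_of_lt_one (by positivity) ?_)
    rw [← Real.rpow_mul (by positivity), one_div_mul_cancel h0.ne', Real.rpow_one,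
      div_lt_one (by positivity)]
    linarith

/-- upper bound, nonnegative argument -/
lemma mittagLeffler_le {ν x ε : ℝ} (h0 : 0 < ν) (hx : 0 ≤ x) (hε : 0 < ε) :
    mittagLeffler ν x ≤
      Real.exp ((1 + ε) * x ^ (1 / ν)) * (1 - ((1 + ε) ^ ν)⁻¹)⁻¹ := by
  have hlt : ((1 + ε) ^ ν)⁻¹ < 1 :=
    inv_lt_one_of_one_lt₀ (Real.one_lt_rpow (by linarith) h0)
  have hpos : 0 < ((1 + ε) ^ ν)⁻¹ := by positivity
  rcases hx.eq_or_lt with rfl | hx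
  · have : mittagLeffler ν 0 = 1 := by
      rw [mittagLeffler, tsum_eq_single 0]
      · simp
      · intro k hk; simp [hk]
    rw [this, Real.zero_rpow (by positivity), mul_zero, Real.exp_zero, one_mul]
    exact (one_le_inv₀ (by linarith)).2 (by linarith)
  have hT : 0 < x ^ (1 / ν) := by positivity
  have e : x / ((1 + ε) * x ^ (1 / ν)) ^ ν = ((1 + ε) ^ ν)⁻¹ := by
    rw [Real.mul_rpow (by positivity) hT.le, ← Real.rpow_mul hx.le, one_div_mul_cancel h0.ne',
      Real.rpow_one]
    field_simp
  have hb : ∀ k : ℕ, x ^ k / Real.Gamma (ν * k + 1) ≤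
      Real.exp ((1 + ε) * x ^ (1 / ν)) * (((1 + ε) ^ ν)⁻¹) ^ k := by
    intro k
    rw [← e]
    exact mittagLeffler_term_le h0 hx.le (by positivity) k
  rw [mittagLeffler]
  refine ((mittagLeffler_summable h0 hx.le).tsum_le_tsum hb
    ((summable_geometric_of_lt_one hpos.le hlt).mul_left _)).trans (le_of_eq ?_)
  rw [tsum_mul_left, tsum_geometric_of_lt_one hpos.le hlt]

lemma mittagLeffler_ge_one {ν x : ℝ} (h0 : 0 < ν) (hx : 0 ≤ x) : 1 ≤ mittagLeffler ν x := by
  have := (mittagLeffler_summable h0 hx).le_tsum 0 (fun k _ => by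
    have := Real.Gamma_pos_of_pos (s := ν * k + 1) (by positivity)
    positivity)
  simpa [mittagLeffler] using this

/-- lower bound, positive argument -/
lemma le_mittagLeffler {ν x : ℝ} (h0 : 0 < ν) (h1 : ν < 1) (hx : 1 ≤ x) :
    Real.exp (x ^ (1 / ν)) / (1 + x ^ (1 / ν)) ≤ mittagLeffler ν x := by
  set T := x ^ (1 / ν) with hT
  have hT1 : 1 ≤ T := Real.one_le_rpow hx (by positivity)
  have hTx : T ^ ν = x := by
    rw [hT, ← Real.rpow_mul (by positivity), one_div_mul_cancel h0.ne', Real.rpow_one]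
  let i : ℕ → ℕ := fun j => ⌈(j : ℝ) / ν⌉₊
  have hi1 : ∀ j : ℕ, (j : ℝ) ≤ ν * i j := fun j => by
    have := Nat.le_ceil ((j : ℝ) / ν)
    rw [div_le_iff₀ h0] at this
    linarith
  have hi2 : ∀ j : ℕ, ν * i j < j + 1 := fun j => by
    have := Nat.ceil_lt_add_one (a := (j : ℝ) / ν) (by positivity)
    calc ν * i j < ν * ((j : ℝ) / ν + 1) := by gcongr
      _ = j + ν := by field_simp
      _ < _ := by linarith
  have hinj : Function.Injective i := by
    intro j j' h
    have a1 := hi1 j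
    have a2 := hi2 j
    have b1 := hi1 j'
    have b2 := hi2 j'
    rw [h] at a1 a2
    have c1 : (j : ℝ) < ((j' + 1 : ℕ) : ℝ) := by push_cast; linarith
    have c2 : (j' : ℝ) < ((j + 1 : ℕ) : ℝ) := by push_cast; linarith
    have := Nat.cast_lt.1 c1
    have := Nat.cast_lt.1 c2
    omega
  have hsum := mittagLeffler_summable h0 (by linarith : (0 : ℝ) ≤ x)
  have hle := tsum_comp_le_tsum_of_inj hsum (fun k => by
    have := Real.Gamma_pos_of_pos (s := ν * k + 1) (by positivity)
    positivity) hinj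
  have hterm : ∀ j : ℕ, T ^ j / ((j + 1).factorial : ℝ) ≤
      ((fun k : ℕ => x ^ k / Real.Gamma (ν * k + 1)) ∘ i) j := by
    intro j
    simp only [Function.comp]
    have hGp := Real.Gamma_pos_of_pos (s := ν * i j + 1) (by positivity)
    have hG : Real.Gamma (ν * i j + 1) ≤ (j + 1).factorial := by
      rcases Nat.eq_zero_or_pos j with rfl | hj
      · simp [i]
      · rw [← Real.Gamma_nat_eq_factorial]
        have hj1 : (1 : ℝ) ≤ j := by exact_mod_cast hj
        have := hi1 j
        have := hi2 j
        refine Real.Gamma_strictMonoOn_Ici.monotoneOn ?_ ?_ ?_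
        · simp only [Set.mem_Ici]; linarith
        · simp only [Set.mem_Ici]; push_cast; linarith
        · push_cast; linarith
    have hp : T ^ j ≤ x ^ (i j) := by
      calc T ^ j = T ^ (j : ℝ) := (Real.rpow_natCast _ _).symm
        _ ≤ T ^ (ν * i j) := Real.rpow_le_rpow_of_exponent_le hT1 (hi1 j)
        _ = x ^ (i j) := by rw [Real.rpow_mul (by positivity), hTx, Real.rpow_natCast]
    gcongr
  have hexp : HasSum (fun j : ℕ => T ^ j / ((j + 1).factorial : ℝ)) ((Real.exp T - 1) / T) := by
    have h : HasSum (fun j : ℕ => T ^ j / (j.factorial : ℝ)) (Real.exp T) := by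
      rw [Real.exp_eq_exp_ℝ]
      exact NormedSpace.expSeries_div_hasSum_exp T
    have h' := ((hasSum_nat_add_iff' 1).2 h).div_const T
    simp only [Finset.sum_range_one, pow_zero, Nat.factorial_zero, Nat.cast_one, div_one] at h'
    refine h'.congr_fun ?_
    intro j
    rw [pow_succ]
    field_simp
  have hfin : (Real.exp T - 1) / T ≤ mittagLeffler ν x := by
    rw [← hexp.tsum_eq]
    exact (hexp.summable.tsum_le_tsum hterm (hsum.comp_injective hinj)).trans hle
  refine le_trans ?_ hfin
  rw [div_le_div_iff₀ (by positivity) (by positivity)]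
  nlinarith [Real.add_one_le_exp T]

lemma log_mittagLeffler_le {ν ε : ℝ} (h0 : 0 < ν) (h1 : ν < 1) (hε : 0 < ε) :
    ∃ C, ∀ x, Real.log (mittagLeffler ν x) ≤ (1 + ε) * (max x 0) ^ (1 / ν) + C := by
  have hlt : ((1 + ε) ^ ν)⁻¹ < 1 :=
    inv_lt_one_of_one_lt₀ (Real.one_lt_rpow (by linarith) h0)
  have hpos : 0 < ((1 + ε) ^ ν)⁻¹ := by positivity
  refine ⟨Real.log ((1 - ((1 + ε) ^ ν)⁻¹)⁻¹), fun x => ?_⟩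
  have hC : 0 ≤ Real.log ((1 - ((1 + ε) ^ ν)⁻¹)⁻¹) :=
    Real.log_nonneg ((one_le_inv₀ (by linarith)).2 (by linarith))
  have hq : 0 < (1 - ((1 + ε) ^ ν)⁻¹)⁻¹ := inv_pos.2 (by linarith)
  rcases le_total 0 x with hx | hx
  · rw [max_eq_left hx]
    have h := Real.log_le_log (by linarith [mittagLeffler_ge_one h0 hx]) (mittagLeffler_le h0 hx hε)
    rwa [Real.log_mul (Real.exp_pos _).ne' hq.ne', Real.log_exp] at h
  · obtain ⟨b1, b2⟩ := mittagLeffler_neg_bounds h0 h1 (neg_nonneg.2 hx)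
    rw [neg_neg] at b1 b2
    have := Real.log_nonpos ((Real.exp_pos _).le.trans b1) b2
    have : 0 ≤ (max x 0) ^ (1 / ν) := by positivity
    nlinarith

lemma le_log_mittagLeffler {ν ε : ℝ} (h0 : 0 < ν) (h1 : ν < 1) (hε : 0 < ε) :
    ∃ C, ∀ x, (1 - ε) * (max x 0) ^ (1 / ν) - C - (1 / Real.Gamma (ν + 1)) * |x|
      ≤ Real.log (mittagLeffler ν x) := by
  refine ⟨1 + ε + |Real.log ε|, fun x => ?_⟩
  have hG := Real.Gamma_pos_of_pos (s := ν + 1) (by positivity)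
  have hGx : 0 ≤ (1 / Real.Gamma (ν + 1)) * |x| := by positivity
  have habs := neg_abs_le (Real.log ε)
  have habs0 := abs_nonneg (Real.log ε)
  rcases le_total 0 x with hx | hx
  · rw [max_eq_left hx]
    rcases le_total 1 x with hx1 | hx1
    · have hT : 0 < x ^ (1 / ν) := by positivity
      have h := Real.log_le_log (by positivity) (le_mittagLeffler h0 h1 hx1)
      rw [Real.log_div (Real.exp_pos _).ne' (by positivity), Real.log_exp] at h
      have h2 := Real.log_le_sub_one_of_pos (x := ε * (1 + x ^ (1 / ν))) (by positivity)
      rw [Real.log_mul hε.ne' (by positivity)] at h2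
      nlinarith
    · have h := Real.log_nonneg (mittagLeffler_ge_one h0 hx)
      have h2 : x ^ (1 / ν) ≤ 1 := Real.rpow_le_one hx hx1 (by positivity)
      have h3 : 0 ≤ x ^ (1 / ν) := by positivity
      nlinarith
  · obtain ⟨b1, b2⟩ := mittagLeffler_neg_bounds h0 h1 (neg_nonneg.2 hx)
    rw [neg_neg] at b1 b2
    have := Real.log_le_log (Real.exp_pos _) b1
    rw [Real.log_exp] at this
    rw [max_eq_right hx, Real.zero_rpow (by positivity), abs_of_nonpos hx]
    nlinarith

/-- abstract limit -/
lemma tendsto_log_mittagLeffler {ν : ℝ} (h0 : 0 < ν) (h1 : ν < 1) {a y : ℝ → ℝ} {Y : ℝ}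
    (ha_pos : ∀ t > 0, 0 < a t) (ha0 : Tendsto a atTop (nhds 0))
    (hy : Tendsto y atTop (nhds Y)) :
    Tendsto (fun t => a t * Real.log (mittagLeffler ν (y t * (a t) ^ (-ν)))) atTop
      (nhds ((max Y 0) ^ (1 / ν))) := by
  set L := (max Y 0) ^ (1 / ν) with hL
  have hL0 : 0 ≤ L := by positivity
  have hS : Tendsto (fun t => (max (y t) 0) ^ (1 / ν)) atTop (nhds L) :=
    (hy.max tendsto_const_nhds).rpow_const (Or.inr (by positivity))
  have hR : Tendsto (fun t => |y t| * (a t) ^ (1 - ν)) atTop (nhds 0) := by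
    have := hy.abs.mul (ha0.rpow_const (p := 1 - ν) (Or.inr (by linarith)))
    rwa [Real.zero_rpow (by linarith), mul_zero] at this
  have e1 : ∀ t > 0, a t * (max (y t * (a t) ^ (-ν)) 0) ^ (1 / ν) = (max (y t) 0) ^ (1 / ν) := by
    intro t ht
    have := ha_pos t ht
    have hp : 0 < (a t) ^ (-ν) := by positivity
    rw [show max (y t * (a t) ^ (-ν)) 0 = max (y t) 0 * (a t) ^ (-ν) by
      rw [max_mul_of_nonneg _ _ hp.le, zero_mul],
      Real.mul_rpow (by positivity) hp.le, ← Real.rpow_mul this.le,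
      show -ν * (1 / ν) = -1 by field_simp, Real.rpow_neg_one]
    field_simp
  have e2 : ∀ t > 0, a t * |y t * (a t) ^ (-ν)| = |y t| * (a t) ^ (1 - ν) := by
    intro t ht
    have := ha_pos t ht
    rw [abs_mul, abs_of_pos (by positivity : 0 < (a t) ^ (-ν)), sub_eq_add_neg,
      Real.rpow_add this, Real.rpow_one]
    ring
  refine tendsto_order.2 ⟨fun b hb => ?_, fun b hb => ?_⟩
  · obtain ⟨ε, hε, hεb⟩ : ∃ ε > 0, b < (1 - ε) * L := by
      refine ⟨(L - b) / (2 * (L + 1)), div_pos (by linarith) (by positivity), ?_⟩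
      have : (L - b) / (2 * (L + 1)) * L ≤ (L - b) / 2 := by
        rw [div_mul_eq_mul_div, div_le_div_iff₀ (by positivity) (by positivity)]
        nlinarith
      linarith
    obtain ⟨C, hC⟩ := le_log_mittagLeffler h0 h1 hε
    have ht : Tendsto (fun t => (1 - ε) * (max (y t) 0) ^ (1 / ν) - a t * C
        - (1 / Real.Gamma (ν + 1)) * (|y t| * (a t) ^ (1 - ν))) atTop
        (nhds ((1 - ε) * L - 0 * C - (1 / Real.Gamma (ν + 1)) * 0)) :=
      ((hS.const_mul _).sub (ha0.mul_const C)).sub (hR.const_mul _)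
    filter_upwards [ht.eventually_const_lt (u := b) (by linarith), eventually_gt_atTop 0] with t h1 h2
    refine h1.trans_le ?_
    have := mul_le_mul_of_nonneg_left (hC (y t * (a t) ^ (-ν))) (ha_pos t h2).le
    rw [← e1 t h2, ← e2 t h2]
    linarith
  · obtain ⟨ε, hε, hεb⟩ : ∃ ε > 0, (1 + ε) * L < b := by
      refine ⟨(b - L) / (2 * (L + 1)), div_pos (by linarith) (by positivity), ?_⟩
      have : (b - L) / (2 * (L + 1)) * L ≤ (b - L) / 2 := by
        rw [div_mul_eq_mul_div, div_le_div_iff₀ (by positivity) (by positivity)]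
        nlinarith
      linarith
    obtain ⟨C, hC⟩ := log_mittagLeffler_le h0 h1 hε
    have ht : Tendsto (fun t => (1 + ε) * (max (y t) 0) ^ (1 / ν) + a t * C) atTop
        (nhds ((1 + ε) * L + 0 * C)) :=
      (hS.const_mul _).add (ha0.mul_const C)
    filter_upwards [ht.eventually_lt_const (u := b) (by linarith), eventually_gt_atTop 0] with t h1 h2
    refine lt_of_le_of_lt ?_ h1
    have := mul_le_mul_of_nonneg_left (hC (y t * (a t) ^ (-ν))) (ha_pos t h2).le
    rw [← e1 t h2]
    linarith

/-- Gärtner–Ellis limit for the noncentral moderate deviations of a time-changed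
Lévy process in the case `m = ∇κ_S(0) ≠ 0`: if `κ : ℝ^h → ℝ` is differentiable
near the origin with `κ(0) = 0` and gradient `m ≠ 0` at `0` (expressed via the
first-order Taylor expansion), then for any positive scalings `a_t → 0` with
`t·a_t → ∞` and any `θ ∈ ℝ^h`, `a_t log E_ν(κ((a_t t)^{-ν} θ) t^ν)` converges, as
`t → ∞`, to `(⟨θ, m⟩)^{1/ν}` if `⟨θ, m⟩ ≥ 0` and to `0` if `⟨θ, m⟩ < 0`. -/
theorem gartnerEllis_limit_timeChanged_gradient_ne_zero
    {h : ℕ} {ν : ℝ} (hν : ν ∈ Set.Ioo (0 : ℝ) 1)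
    (κ : (Fin h → ℝ) → ℝ) (m : Fin h → ℝ) (hm : m ≠ 0)
    (hdiff : ∀ᶠ u in nhds (0 : Fin h → ℝ), DifferentiableAt ℝ κ u)
    (hκ0 : κ 0 = 0)
    (hTaylor : (fun u : Fin h → ℝ => κ u - dotProduct m u)
        =o[nhds 0] fun u => ‖u‖)
    (a : ℝ → ℝ) (ha_pos : ∀ t > 0, 0 < a t)
    (ha0 : Tendsto a atTop (nhds 0))
    (hta : Tendsto (fun t => t * a t) atTop atTop)
    (θ : Fin h → ℝ) :
    Tendsto (fun t : ℝ =>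
        a t * Real.log (mittagLeffler ν (κ ((a t * t) ^ (-ν) • θ) * t ^ ν)))
      atTop
      (nhds (if 0 ≤ dotProduct θ m then dotProduct θ m ^ (1 / ν) else 0)) := by
  obtain ⟨h0, h1⟩ := hν
  have hlim : (if 0 ≤ dotProduct θ m then dotProduct θ m ^ (1 / ν) else 0)
      = (max (dotProduct θ m) 0) ^ (1 / ν) := by
    split_ifs with hc
    · rw [max_eq_left hc]
    · rw [max_eq_right (not_le.1 hc).le, Real.zero_rpow (by positivity)]
  rw [hlim]
  have hs : Tendsto (fun t => (a t * t) ^ (-ν)) atTop (nhds 0) := by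
    refine (tendsto_rpow_neg_atTop h0).comp (hta.congr fun t => mul_comm _ _)
  have hu : Tendsto (fun t => (a t * t) ^ (-ν) • θ) atTop (nhds 0) := by
    simpa using hs.smul_const θ
  have hy : Tendsto (fun t => κ ((a t * t) ^ (-ν) • θ) * (a t * t) ^ ν) atTop
      (nhds (dotProduct θ m)) := by
    have ho := hTaylor.comp_tendsto hu
    have ho2 : (fun t => κ ((a t * t) ^ (-ν) • θ) - dotProduct m ((a t * t) ^ (-ν) • θ))
        =o[atTop] (fun t => (a t * t) ^ (-ν)) := by
      refine ho.trans_isBigO (Asymptotics.IsBigO.of_bound ‖θ‖ (Eventually.of_forall fun t => ?_))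
      simp only [Function.comp]
      rw [norm_norm, norm_smul, mul_comm]
    have ho3 := ho2.tendsto_div_nhds_zero.add_const (dotProduct θ m)
    rw [zero_add] at ho3
    refine ho3.congr' ?_
    filter_upwards [eventually_gt_atTop 0] with t ht
    have hat : 0 < a t * t := mul_pos (ha_pos t ht) ht
    have hp : 0 < (a t * t) ^ ν := by positivity
    rw [dotProduct_smul, Real.rpow_neg hat.le, dotProduct_comm m θ, smul_eq_mul]
    field_simp
    ring
  refine (tendsto_log_mittagLeffler h0 h1 ha_pos ha0 hy).congr' ?_
  filter_upwards [eventually_gt_atTop 0] with t ht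
  have hat := ha_pos t ht
  have : (a t * t) ^ ν * (a t) ^ (-ν) = t ^ ν := by
    rw [Real.mul_rpow hat.le ht.le, Real.rpow_neg hat.le]
    have hp : 0 < (a t) ^ ν := by positivity
    field_simp
  rw [mul_assoc, this]
end
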